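/- For all integers N ≥ 2 and all integers l with 0 ≤ l ≤ 2N, one has (1/N) · Σ_{n=1}^{N−1} (1 − cos(lnπ/N)) / (1 − cos(nπ/N))² = l⁴/(12N) − l³/3 + l²N/3 − l²/(6N) + (−1)^l/(8N) + l/3 − 1/(8N). -/

import Mathlib

open Finset Real

lemma aux_tele (x : ℝ) (M : ℕ) :
    2 * Real.sin (x / 2) * ∑ n ∈ Finset.Icc 1 M, Real.cos (n * x)
      = Real.sin (M * x + x / 2) - Real.sin (x / 2) := by
  induction M with
  | zero => simp
  | succ k ih =>
    rw [Finset.sum_Icc_succ_top (by omega), mul_add, ih]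
    have h1 : (k : ℝ) * x + x / 2 = ((k + 1 : ℕ) : ℝ) * x - x / 2 := by push_cast; ring
    rw [h1, Real.sin_sub, Real.sin_add]
    ring

lemma aux_c (N : ℕ) (hN : 2 ≤ N) (l : ℕ) (h0 : 0 < l) (hl : l < 2 * N) :
    ∑ n ∈ Finset.Icc 1 (N - 1), Real.cos (l * n * Real.pi / N) = -(1 + (-1 : ℝ) ^ l) / 2 := by
  have hNp : (0 : ℝ) < N := by exact_mod_cast (by omega : 0 < N)
  have hlp : (0 : ℝ) < l := by exact_mod_cast h0
  have hl' : (l : ℝ) < 2 * N := by exact_mod_cast hl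
  have ht := aux_tele (l * Real.pi / N) (N - 1)
  have hs : 0 < Real.sin (l * Real.pi / N / 2) := by
    apply Real.sin_pos_of_pos_of_lt_pi
    · positivity
    · rw [div_div, div_lt_iff₀ (by positivity)]
      nlinarith [Real.pi_pos]
  have e : ((N - 1 : ℕ) : ℝ) * (l * Real.pi / N) + l * Real.pi / N / 2
      = l * Real.pi - l * Real.pi / N / 2 := by
    rw [Nat.cast_sub (by omega)]
    push_cast
    field_simp
    ring
  rw [e, Real.sin_sub, Real.sin_nat_mul_pi, Real.cos_nat_mul_pi] at ht
  have e2 : ∑ n ∈ Finset.Icc 1 (N - 1), Real.cos (l * n * Real.pi / N)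
      = ∑ n ∈ Finset.Icc 1 (N - 1), Real.cos (n * (l * Real.pi / N)) := by
    apply Finset.sum_congr rfl
    intro n _
    congr 1
    ring
  rw [e2]
  have hs' := hs.ne'
  apply mul_left_cancel₀ (mul_ne_zero two_ne_zero hs')
  rw [ht]
  ring

lemma aux_pos (N n : ℕ) (hn : n ∈ Finset.Icc 1 (N - 1)) :
    1 - Real.cos (n * Real.pi / N) ≠ 0 := by
  rw [Finset.mem_Icc] at hn
  have hNp : (0 : ℝ) < N := by exact_mod_cast (by omega : 0 < N)
  have hnp : (0 : ℝ) < n := by exact_mod_cast (by omega : 0 < n)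
  have hnN : (n : ℝ) < N := by exact_mod_cast (by omega : n < N)
  have h : Real.cos (n * Real.pi / N) < Real.cos 0 := by
    apply Real.cos_lt_cos_of_nonneg_of_le_pi le_rfl
    · rw [div_le_iff₀ hNp]
      nlinarith [Real.pi_pos]
    · positivity
  rw [Real.cos_zero] at h
  linarith

lemma aux_cos (N l n : ℕ) :
    Real.cos ((l + 2 : ℕ) * n * Real.pi / N) = 2 * Real.cos ((l + 1 : ℕ) * n * Real.pi / N)
      * Real.cos (n * Real.pi / N) - Real.cos (l * n * Real.pi / N) := by
  have h1 : ((l + 2 : ℕ) : ℝ) * n * Real.pi / N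
      = (l + 1 : ℕ) * n * Real.pi / N + n * Real.pi / N := by push_cast; ring
  have h2 : (l : ℝ) * n * Real.pi / N
      = (l + 1 : ℕ) * n * Real.pi / N - n * Real.pi / N := by push_cast; ring
  rw [h1, h2, Real.cos_add, Real.cos_sub]
  ring

noncomputable def auxG (N l : ℕ) : ℝ := ∑ n ∈ Finset.Icc 1 (N - 1),
  Real.cos (l * n * Real.pi / N) / (1 - Real.cos (n * Real.pi / N))

noncomputable def auxF (N l : ℕ) : ℝ := ∑ n ∈ Finset.Icc 1 (N - 1),
  (1 - Real.cos (l * n * Real.pi / N)) / (1 - Real.cos (n * Real.pi / N)) ^ 2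

lemma auxG_rec (N l : ℕ) : auxG N (l + 2) = 2 * auxG N (l + 1) - auxG N l
    - 2 * ∑ n ∈ Finset.Icc 1 (N - 1), Real.cos ((l + 1 : ℕ) * n * Real.pi / N) := by
  unfold auxG
  rw [Finset.mul_sum, Finset.mul_sum, ← Finset.sum_sub_distrib, ← Finset.sum_sub_distrib]
  apply Finset.sum_congr rfl
  intro n hn
  have := aux_pos N n hn
  rw [aux_cos]
  generalize Real.cos (n * Real.pi / N) = a at *
  generalize Real.cos ((l + 1 : ℕ) * n * Real.pi / N) = b at *
  field_simp
  ring

lemma auxF_rec (N l : ℕ) : auxF N (l + 2) = 2 * auxF N (l + 1) - auxF N l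
    + 2 * auxG N (l + 1) := by
  unfold auxG auxF
  rw [Finset.mul_sum, Finset.mul_sum, ← Finset.sum_sub_distrib, ← Finset.sum_add_distrib]
  apply Finset.sum_congr rfl
  intro n hn
  have := aux_pos N n hn
  rw [aux_cos]
  generalize Real.cos (n * Real.pi / N) = a at *
  generalize Real.cos ((l + 1 : ℕ) * n * Real.pi / N) = b at *
  field_simp
  ring

lemma auxF_zero (N : ℕ) : auxF N 0 = 0 := by
  simp [auxF]

lemma auxF_one (N : ℕ) : auxF N 1 = auxG N 0 := by
  unfold auxG auxF
  apply Finset.sum_congr rfl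
  intro n hn
  have := aux_pos N n hn
  simp only [Nat.cast_one, one_mul, Nat.cast_zero, zero_mul, zero_div, Real.cos_zero]
  field_simp

lemma auxG_one (N : ℕ) (hN : 2 ≤ N) : auxG N 1 = auxG N 0 - (N - 1) := by
  have h : ∑ n ∈ Finset.Icc 1 (N - 1), (1 : ℝ) = N - 1 := by
    simp [Nat.cast_sub (by omega : 1 ≤ N)]
  rw [← h]
  unfold auxG
  rw [← Finset.sum_sub_distrib]
  apply Finset.sum_congr rfl
  intro n hn
  have := aux_pos N n hn
  simp only [Nat.cast_one, one_mul, Nat.cast_zero, zero_mul, zero_div, Real.cos_zero]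
  field_simp
  ring

lemma auxF_end (N : ℕ) (hN : 2 ≤ N) : auxF N (2 * N) = 0 := by
  have hNp : (N : ℝ) ≠ 0 := by exact_mod_cast (by omega : N ≠ 0)
  unfold auxF
  apply Finset.sum_eq_zero
  intro n hn
  have e : ((2 * N : ℕ) : ℝ) * n * Real.pi / N = n * (2 * Real.pi) := by
    push_cast
    field_simp
  rw [e, Real.cos_nat_mul_two_pi]
  simp

lemma auxG_closed (N : ℕ) (hN : 2 ≤ N) (l : ℕ) : l ≤ 2 * N →
    auxG N l = auxG N 0 + (l : ℝ) ^ 2 / 2 - N * l + (1 - (-1 : ℝ) ^ l) / 4 := by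
  induction l using Nat.twoStepInduction with
  | zero => intro _; simp
  | one => intro _; rw [auxG_one N hN]; push_cast; ring
  | more l ih1 ih2 =>
    intro h
    rw [auxG_rec, aux_c N hN (l + 1) (by omega) (by omega), ih2 (by omega), ih1 (by omega)]
    push_cast
    ring

lemma auxF_closed (N : ℕ) (hN : 2 ≤ N) (l : ℕ) : l ≤ 2 * N →
    auxF N l = (l : ℝ) ^ 4 / 12 - N * (l : ℝ) ^ 3 / 3 + auxG N 0 * (l : ℝ) ^ 2
      + (l : ℝ) ^ 2 / 6 + ((-1 : ℝ) ^ l - 1) / 8 + l * N / 3 := by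
  induction l using Nat.twoStepInduction with
  | zero => intro _; simp [auxF_zero]
  | one => intro _; rw [auxF_one N]; push_cast; ring
  | more l ih1 ih2 =>
    intro h
    rw [auxF_rec, auxG_closed N hN (l + 1) (by omega), ih2 (by omega), ih1 (by omega)]
    push_cast
    ring

theorem path_trig_sum_FN (N : ℕ) (hN : 2 ≤ N) (l : ℕ) (hl : l ≤ 2 * N) :
    (1 / (N : ℝ)) * ∑ n ∈ Finset.Icc 1 (N - 1),
        (1 - Real.cos (l * n * Real.pi / N)) / (1 - Real.cos (n * Real.pi / N)) ^ 2
      = (l : ℝ) ^ 4 / (12 * N) - (l : ℝ) ^ 3 / 3 + (l : ℝ) ^ 2 * N / 3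
          - (l : ℝ) ^ 2 / (6 * N) + (-1 : ℝ) ^ l / (8 * N) + (l : ℝ) / 3 - 1 / (8 * N) := by
  have hNp : (N : ℝ) ≠ 0 := by exact_mod_cast (by omega : N ≠ 0)
  have h1 := auxF_closed N hN (2 * N) le_rfl
  rw [auxF_end N hN, pow_mul (-1 : ℝ) 2 N] at h1
  norm_num at h1
  have hg : auxG N 0 = ((N : ℝ) ^ 2 - 1) / 3 := by
    apply mul_left_cancel₀ (pow_ne_zero 2 hNp)
    linarith
  have h2 := auxF_closed N hN l hl
  rw [hg] at h2
  change (1 / (N : ℝ)) * auxF N l = _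
  rw [h2]
  field_simp
  ring
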